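/- Informed-guess value for all three outcomes in the bilocality scenario with a Bell-state measurement: with ρ = |Ψ⁻⟩⟨Ψ⁻| ⊗ |Ψ⁻⟩⟨Ψ⁻| (16×16 matrix, ordering A,B₁,B₂,C), one has max over a,c∈{0,1} and b∈{1,2,3,4} of Tr[ρ·(Π⁰_a ⊗ P_b ⊗ Π⁰_c)] = 1/8. (This is the informed-guess probability for guessing the outcomes of all three parties, corresponding to at most 3 certifiable bits.) -/

import Mathlib

open Matrix Kronecker

noncomputable section

abbrev M2 := Matrix (Fin 2) (Fin 2) ℂ
abbrev M4 := Matrix (Fin 2 × Fin 2) (Fin 2 × Fin 2) ℂ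
abbrev Quad := Fin 2 × Fin 2 × Fin 2 × Fin 2
abbrev M16 := Matrix Quad Quad ℂ

/-- Pauli Z matrix. -/
def σz : M2 := !![1, 0; 0, -1]
/-- Pauli X matrix. -/
def σx : M2 := !![0, 1; 1, 0]

/-- The complex number 1/√2. -/
def invSqrt2 : ℂ := ((Real.sqrt 2 : ℝ) : ℂ)⁻¹

/-- Bell state Φ⁺ = (|00⟩+|11⟩)/√2. -/
def PhiP : Fin 2 × Fin 2 → ℂ := fun p =>
  if p = (0, 0) then invSqrt2 else if p = (1, 1) then invSqrt2 else 0
/-- Bell state Φ⁻ = (|00⟩−|11⟩)/√2. -/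
def PhiM : Fin 2 × Fin 2 → ℂ := fun p =>
  if p = (0, 0) then invSqrt2 else if p = (1, 1) then -invSqrt2 else 0
/-- Bell state Ψ⁺ = (|01⟩+|10⟩)/√2. -/
def PsiP : Fin 2 × Fin 2 → ℂ := fun p =>
  if p = (0, 1) then invSqrt2 else if p = (1, 0) then invSqrt2 else 0
/-- Bell state Ψ⁻ = (|01⟩−|10⟩)/√2. -/
def PsiM : Fin 2 × Fin 2 → ℂ := fun p =>
  if p = (0, 1) then invSqrt2 else if p = (1, 0) then -invSqrt2 else 0

/-- Rank-one projector |ψ⟩⟨ψ|. -/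
def proj {n : Type*} (ψ : n → ℂ) : Matrix n n ℂ := vecMulVec ψ (star ψ)

/-- The four Bell states, ordered Φ⁺, Φ⁻, Ψ⁺, Ψ⁻. -/
def Bell : Fin 4 → (Fin 2 × Fin 2 → ℂ) := ![PhiP, PhiM, PsiP, PsiM]

/-- Projectors onto the Bell states. -/
def P (b : Fin 4) : M4 := proj (Bell b)

/-- Kronecker product M_A ⊗ M_{B₁B₂} ⊗ M_C, in the tensor ordering A, B₁, B₂, C. -/
def kron3 (MA : M2) (MB : M4) (MC : M2) : M16 := fun p q =>
  MA p.1 q.1 * MB (p.2.1, p.2.2.1) (q.2.1, q.2.2.1) * MC p.2.2.2 q.2.2.2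

/-- The two-singlet state vector |Ψ⁻⟩_{AB₁} ⊗ |Ψ⁻⟩_{B₂C}. -/
def twoSinglets : Quad → ℂ := fun p => PsiM (p.1, p.2.1) * PsiM (p.2.2.1, p.2.2.2)

/-- The density matrix ρ = |Ψ⁻⟩⟨Ψ⁻| ⊗ |Ψ⁻⟩⟨Ψ⁻| on A, B₁, B₂, C. -/
def ρ₂ : M16 := proj twoSinglets

/-- Spectral projectors Πˣ_a = ½(I₂ + (−1)^a (σz + (−1)^x σx)/√2) of the
observables (σz ± σx)/√2. -/
def Proj (x a : Fin 2) : M2 :=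
  (1 / 2 : ℂ) • ((1 : M2) + (((-1 : ℂ) ^ (a : ℕ)) * invSqrt2) • (σz + ((-1 : ℂ) ^ (x : ℕ)) • σx))

/-- Eigenprojectors Qʸ_s = ½(I₄ + (−1)^s σ⊗σ) of σz⊗σz (y = 0) and σx⊗σx (y = 1);
s = 0 is the "+" projector and s = 1 the "−" projector. -/
def Q (y s : Fin 2) : M4 :=
  (1 / 2 : ℂ) • ((1 : M4) + ((-1 : ℂ) ^ (s : ℕ)) • (if y = 0 then σz ⊗ₖ σz else σx ⊗ₖ σx))

/-- Correlator ⟨ψ|(A ⊗ C)|ψ⟩ of two single-qubit observables on a two-qubit state. -/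
def corr (ψ : Fin 2 × Fin 2 → ℂ) (A C : M2) : ℂ := star ψ ⬝ᵥ ((A ⊗ₖ C) *ᵥ ψ)

lemma star_s : (starRingEnd ℂ) invSqrt2 = invSqrt2 := by
  simp [invSqrt2]

lemma s_sq : invSqrt2 ^ 2 = 1 / 2 := by
  have h : ((Real.sqrt 2 : ℝ) : ℂ) ^ 2 = 2 := by
    rw [← Complex.ofReal_pow, Real.sq_sqrt (by norm_num)]; norm_num
  rw [invSqrt2, inv_pow, h]; norm_num

lemma tr_formula (M N : M2) (φ : Fin 2 × Fin 2 → ℂ) :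
    trace (ρ₂ * kron3 M (proj φ) N) = 1 / 4 * ∑ i : Fin 2, ∑ j : Fin 2, ∑ k : Fin 2, ∑ l : Fin 2,
      (-1) ^ (i + j + k + l : ℕ) * M i j * N k l * φ (1 - i, 1 - k) * star (φ (1 - j, 1 - l)) := by
  have h4 : invSqrt2 ^ 4 = 1 / 4 := by
    rw [show invSqrt2 ^ 4 = (invSqrt2 ^ 2) ^ 2 by ring, s_sq]; norm_num
  rw [← h4]
  simp only [trace, diag, mul_apply, ρ₂, kron3, proj, vecMulVec_apply, twoSinglets, PsiM,
    Fintype.sum_prod_type, Fin.sum_univ_two, Pi.star_apply]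
  simp [star_s]
  ring

set_option maxHeartbeats 4000000 in
lemma val (a c : Fin 2) (b : Fin 4) :
    trace (ρ₂ * kron3 (Proj 0 a) (P b) (Proj 0 c)) =
      (1 + (-1) ^ (a + c : ℕ) * (![1, 0, 0, -1] : Fin 4 → ℂ) b) / 16 := by
  have h := s_sq
  have h4 : invSqrt2 ^ 4 = 1 / 4 := by
    rw [show invSqrt2 ^ 4 = (invSqrt2 ^ 2) ^ 2 by ring, s_sq]; norm_num
  rw [P, tr_formula]
  fin_cases b <;> fin_cases a <;> fin_cases c <;>
    simp [Fin.sum_univ_two, Bell, PhiP, PhiM, PsiP, PsiM, Proj, σz, σx, star_s] <;>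
    ring_nf <;> simp only [h, h4] <;> norm_num

lemma val_re (a c : Fin 2) (b : Fin 4) :
    (trace (ρ₂ * kron3 (Proj 0 a) (P b) (Proj 0 c))).re =
      (1 + (-1) ^ (a + c : ℕ) * (![1, 0, 0, -1] : Fin 4 → ℝ) b) / 16 := by
  rw [val]
  fin_cases b <;> fin_cases a <;> fin_cases c <;> norm_num

/-- Informed-guess value for all three outcomes with a Bell-state measurement:
max_{a,c,b} Tr[ρ·(Π⁰_a ⊗ P_b ⊗ Π⁰_c)] = 1/8. -/
theorem informed_guess_ABC_BSM :
    (⨆ a : Fin 2, ⨆ c : Fin 2, ⨆ b : Fin 4,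
      (trace (ρ₂ * kron3 (Proj 0 a) (P b) (Proj 0 c))).re) = 1 / 8 := by
  simp only [val_re]
  apply le_antisymm
  · refine ciSup_le fun a => ciSup_le fun c => ciSup_le fun b => ?_
    fin_cases b <;> fin_cases a <;> fin_cases c <;> norm_num
  · refine le_ciSup_of_le (Set.finite_range _).bddAbove 0 ?_
    refine le_ciSup_of_le (Set.finite_range _).bddAbove 0 ?_
    refine le_ciSup_of_le (Set.finite_range _).bddAbove 0 ?_
    norm_num
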